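/- arXiv:2308.13322 — 9 statements merged into one kernel-verified Lean document; each statement's English description precedes it below -/
import Mathlib

section
/- Let (K, v) be a valued field, a, a' ∈ K and γ, γ' in the value group Γ_v of v. Then the following conditions are equivalent: (i) v_{a',γ'}(f) ≤ v_{a,γ}(f) for every f ∈ K[x]; (ii) γ ≥ γ' and v(a' − a) ≥ γ'; (iii) B(a, γ) ⊆ B(a', γ'). -/
open Polynomial

/-- A valuation on the field `K` with values in `Γ ∪ {∞}`. -/
def IsValdF {K Γ : Type*} [Field K] [AddCommGroup Γ] [LinearOrder Γ] [IsOrderedAddMonoid Γ] (v : K → WithTop Γ) : Prop :=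
  (∀ a b : K, v (a * b) = v a + v b) ∧ (∀ a b : K, min (v a) (v b) ≤ v (a + b)) ∧
    (∀ a : K, v a = ⊤ ↔ a = 0)

/-- The monomial valuation `v_{a,γ}` on `K[x]`:
`v_{a,γ}(c_0 + c_1(x-a) + … + c_r(x-a)^r) = min_i (v(c_i) + i·γ)`. -/
noncomputable def mval {K Γ : Type*} [Field K] [AddCommGroup Γ] [LinearOrder Γ] [IsOrderedAddMonoid Γ]
    (v : K → WithTop Γ) (a : K) (γ : Γ) (f : Polynomial K) : WithTop Γ :=
  (Finset.range (f.natDegree + 1)).inf fun i =>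
    v ((Polynomial.taylor a f).coeff i) + ((i • γ : Γ) : WithTop Γ)

/-- The closed ball `B(a, γ) = {b ∈ K : v(b − a) ≥ γ}`. -/
def vBall {K Γ : Type*} [Field K] [AddCommGroup Γ] [LinearOrder Γ] [IsOrderedAddMonoid Γ]
    (v : K → WithTop Γ) (a : K) (γ : Γ) : Set K :=
  {b : K | (γ : WithTop Γ) ≤ v (b - a)}

theorem aux_coe {K Γ : Type*} [Field K] [AddCommGroup Γ] [LinearOrder Γ] [IsOrderedAddMonoid Γ]
    (v : K → WithTop Γ) (hv : IsValdF v) : ∃ w : AddValuation K (WithTop Γ), ∀ x, w x = v x := by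
  obtain ⟨hm, ha, h0⟩ := hv
  have h1 : v 1 = 0 := by
    have h := hm 1 1
    rw [one_mul] at h
    have hne : v 1 ≠ ⊤ := fun h => one_ne_zero ((h0 1).1 h)
    lift v 1 to Γ using hne with g
    norm_cast at h ⊢
    simpa using h
  exact ⟨AddValuation.of v ((h0 0).2 rfl) h1 ha hm, fun x => rfl⟩

theorem aux_nat {K Γ : Type*} [Field K] [AddCommGroup Γ] [LinearOrder Γ] [IsOrderedAddMonoid Γ]
    (w : AddValuation K (WithTop Γ)) (n : ℕ) : 0 ≤ w (n : K) := by
  induction n with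
  | zero => simp
  | succ n ih =>
    push_cast
    exact w.map_le_add ih (by rw [w.map_one])

theorem aux_le {K Γ : Type*} [Field K] [AddCommGroup Γ] [LinearOrder Γ] [IsOrderedAddMonoid Γ]
    (w : AddValuation K (WithTop Γ)) (a a' : K) (γ γ' : Γ) (h1 : γ' ≤ γ)
    (h2 : (γ' : WithTop Γ) ≤ w (a - a')) (f : Polynomial K) :
    mval w a' γ' f ≤ mval w a γ f := by
  have key : ∀ i, mval w a' γ' f ≤
      w ((taylor a' f).coeff i) + ((i • γ' : Γ) : WithTop Γ) := by
    intro i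
    by_cases hi : i ≤ f.natDegree
    · exact Finset.inf_le (f := fun i => w ((taylor a' f).coeff i) + ((i • γ' : Γ) : WithTop Γ))
        (Finset.mem_range.2 (by omega))
    · rw [coeff_eq_zero_of_natDegree_lt (by rw [natDegree_taylor]; omega)]
      simp
  conv_rhs => unfold mval
  refine Finset.le_inf fun j _ => ?_
  have ht : taylor a f = taylor (a - a') (taylor a' f) := by
    rw [taylor_taylor]; congr 1; ring
  have hj : ((j • γ' : Γ) : WithTop Γ) ≤ ((j • γ : Γ) : WithTop Γ) :=
    WithTop.coe_le_coe.2 (nsmul_le_nsmul_right h1 j)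
  refine le_trans ?_ (add_le_add le_rfl hj)
  -- move the shift to the left
  have hcancel : ∀ x y : WithTop Γ, x + ((-(j • γ') : Γ) : WithTop Γ) ≤ y →
      x ≤ y + ((j • γ' : Γ) : WithTop Γ) := by
    intro x y h
    have := add_le_add h (le_refl ((j • γ' : Γ) : WithTop Γ))
    rwa [add_assoc, ← WithTop.coe_add, neg_add_cancel, WithTop.coe_zero, add_zero] at this
  apply hcancel
  rw [ht, taylor_coeff, eval_eq_sum_range]
  refine w.map_le_sum fun n _ => ?_
  rw [hasseDeriv_coeff, w.map_mul, w.map_mul, w.map_pow]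
  have hn : ((n • γ' : Γ) : WithTop Γ) ≤ n • w (a - a') := by
    rw [WithTop.coe_nsmul]
    exact nsmul_le_nsmul_right h2 n
  calc mval w a' γ' f + ((-(j • γ') : Γ) : WithTop Γ)
      ≤ (w ((taylor a' f).coeff (n + j)) + (((n + j) • γ' : Γ) : WithTop Γ))
        + ((-(j • γ') : Γ) : WithTop Γ) := add_le_add (key _) le_rfl
    _ = 0 + w ((taylor a' f).coeff (n + j)) + ((n • γ' : Γ) : WithTop Γ) := by
        rw [add_assoc, ← WithTop.coe_add, add_nsmul, add_neg_cancel_right, zero_add]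
    _ ≤ _ := add_le_add (add_le_add (aux_nat w _) le_rfl) hn

theorem aux_lin {K Γ : Type*} [Field K] [AddCommGroup Γ] [LinearOrder Γ] [IsOrderedAddMonoid Γ]
    (w : AddValuation K (WithTop Γ)) (a b : K) (γ : Γ) :
    mval w a γ (X - C b) = min (γ : WithTop Γ) (w (a - b)) := by
  have : taylor a (X - C b) = X + C (a - b) := by
    simp [taylor_X, taylor_C]; ring
  unfold mval
  rw [this, natDegree_X_sub_C, Finset.range_add_one, Finset.range_add_one, Finset.range_zero]
  simp [coeff_X, coeff_C]

/-- comparison of monomial valuations.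
`v_{a',γ'} ≤ v_{a,γ}` iff `γ ≥ γ'` and `v(a' − a) ≥ γ'` iff `B(a,γ) ⊆ B(a',γ')`. -/
theorem stmt3 {K Γ : Type*} [Field K] [AddCommGroup Γ] [LinearOrder Γ] [IsOrderedAddMonoid Γ]
    (v : K → WithTop Γ) (hv : IsValdF v) (a a' : K) (γ γ' : Γ)
    (hγ : ∃ c : K, v c = (γ : WithTop Γ)) (hγ' : ∃ c : K, v c = (γ' : WithTop Γ)) :
    ((∀ f : Polynomial K, mval v a' γ' f ≤ mval v a γ f) ↔
      (γ' ≤ γ ∧ (γ' : WithTop Γ) ≤ v (a' - a))) ∧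
    ((γ' ≤ γ ∧ (γ' : WithTop Γ) ≤ v (a' - a)) ↔ vBall v a γ ⊆ vBall v a' γ') := by
  obtain ⟨w, hw⟩ := aux_coe v hv
  obtain rfl : ⇑w = v := funext hw
  rw [w.map_sub_swap a' a]
  refine ⟨⟨fun h => ?_, fun h f => aux_le w a a' γ γ' h.1 h.2 f⟩, fun h b hb => ?_, fun h => ?_⟩
  · have := h (X - C a')
    rw [aux_lin, aux_lin] at this
    simpa using this
  · have hb' : (γ : WithTop Γ) ≤ w (b - a) := hb
    show (γ' : WithTop Γ) ≤ w (b - a')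
    rw [← sub_add_sub_cancel b a a']
    exact w.map_le_add ((WithTop.coe_le_coe.2 h.1).trans hb') h.2
  · have h2 : (γ' : WithTop Γ) ≤ w (a - a') := h (show (γ : WithTop Γ) ≤ w (a - a) by simp)
    obtain ⟨c, hc⟩ := hγ
    have h3 : (γ' : WithTop Γ) ≤ w (a + c - a') :=
      h (show (γ : WithTop Γ) ≤ w (a + c - a) by simp [hc])
    refine ⟨?_, h2⟩
    rw [← WithTop.coe_le_coe, ← hc, show c = (a + c - a') - (a - a') by ring]
    exact w.map_le_sub h3 h2
end

section
/- Let (K, v) be a valued field and {a_i}_{i∈I} a pseudo-Cauchy sequence in K indexed by a well-ordered set I with no greatest element. Then: (a) for every i ∈ I the value v(a_j − a_i) is the same for all j > i; call it γ_i; (b) the family {γ_i}_{i∈I} is strictly increasing; (c) setting ν_i := v_{a_i, γ_i}, for all i < j in I one has ν_i(f) ≤ ν_j(f) for every f ∈ K[x], and ν_i(x − a_j) < ν_j(x − a_j); in particular the family {ν_i}_{i∈I} is a strictly increasing chain of valuations on K[x]. -/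
open Polynomial

theorem IsValdF.map_one' {K Γ : Type*} [Field K] [AddCommGroup Γ] [LinearOrder Γ]
    [IsOrderedAddMonoid Γ] {v : K → WithTop Γ} (hv : IsValdF v) : v 1 = 0 := by
  have h := hv.1 1 1
  have h1 : v 1 ≠ ⊤ := fun h => one_ne_zero ((hv.2.2 1).1 h)
  rw [mul_one] at h
  lift v 1 to Γ using h1 with g
  have h' : g = g + g := by exact_mod_cast h
  have : g = 0 := by simpa using h'
  simp [this]

/-- The additive valuation attached to `v`. -/
noncomputable def IsValdF.val {K Γ : Type*} [Field K] [AddCommGroup Γ] [LinearOrder Γ]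
    [IsOrderedAddMonoid Γ] {v : K → WithTop Γ} (hv : IsValdF v) : AddValuation K (WithTop Γ) :=
  AddValuation.of v ((hv.2.2 0).2 rfl) hv.map_one' hv.2.1 hv.1

theorem mval_mono_aux {K Γ : Type*} [Field K] [AddCommGroup Γ] [LinearOrder Γ]
    [IsOrderedAddMonoid Γ] (w : AddValuation K (WithTop Γ)) (a b : K) (γ δ : Γ)
    (hab : w (b - a) = (γ : WithTop Γ)) (hγ : γ ≤ δ) (f : Polynomial K) :
    mval w a γ f ≤ mval w b δ f := by
  have hnat : ∀ n : ℕ, 0 ≤ w (n : K) := by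
    intro n
    induction n with
    | zero => simp
    | succ n ih =>
      rw [Nat.cast_succ]
      exact w.map_le_add ih (by simp)
  unfold mval
  refine Finset.le_inf fun k _ => ?_
  have ht : taylor b f = taylor (b - a) (taylor a f) := by
    rw [taylor_taylor]; congr 2; ring
  rw [ht]
  set g := taylor a f with hg
  have hdeg : g.natDegree = f.natDegree := natDegree_taylor f a
  rw [taylor_coeff, hasseDeriv_apply, Polynomial.sum_def, eval_finsetSum]
  simp only [eval_monomial]
  set m := (Finset.range (f.natDegree + 1)).inf fun i =>
    w (g.coeff i) + ((i • γ : Γ) : WithTop Γ) with hm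
  have key : m + ((-(k • δ) : Γ) : WithTop Γ) ≤
      w (∑ n ∈ g.support, ((n.choose k : ℕ) : K) * g.coeff n * (b - a) ^ (n - k)) := by
    refine w.map_le_sum fun n hn => ?_
    rcases lt_or_ge n k with hnk | hnk
    · simp [Nat.choose_eq_zero_of_lt hnk]
    have h1 : m ≤ w (g.coeff n) + ((n • γ : Γ) : WithTop Γ) :=
      Finset.inf_le (Finset.mem_range.2 (by
        have := le_natDegree_of_mem_supp n hn
        omega))
    rw [w.map_mul, w.map_mul, w.map_pow, hab]
    have h2 : n • γ + -(k • δ) ≤ (n - k) • γ := by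
      obtain ⟨d, rfl⟩ := Nat.exists_eq_add_of_le hnk
      have : k • γ ≤ k • δ := nsmul_le_nsmul_right hγ k
      rw [Nat.add_sub_cancel_left, add_nsmul, add_comm (k • γ), add_assoc]
      have : k • γ + -(k • δ) ≤ 0 := by simpa using this
      simpa using this
    calc m + ((-(k • δ) : Γ) : WithTop Γ)
        ≤ w (g.coeff n) + ((n • γ : Γ) : WithTop Γ) + ((-(k • δ) : Γ) : WithTop Γ) := by gcongr
      _ = w (g.coeff n) + ((n • γ + -(k • δ) : Γ) : WithTop Γ) := by
          rw [add_assoc, WithTop.coe_add]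
      _ ≤ w (g.coeff n) + (((n - k) • γ : Γ) : WithTop Γ) := by
          gcongr
          exact WithTop.coe_le_coe.2 h2
      _ ≤ w ((n.choose k : ℕ) : K) + w (g.coeff n) + (((n - k) • γ : Γ) : WithTop Γ) := by
          gcongr
          exact le_add_of_nonneg_left (hnat _)
      _ = _ := by rw [WithTop.coe_nsmul]
  calc m = m + ((-(k • δ) : Γ) : WithTop Γ) + ((k • δ : Γ) : WithTop Γ) := by
        rw [add_assoc, ← WithTop.coe_add]; simp
    _ ≤ _ := by gcongr

theorem mval_strict_aux {K Γ : Type*} [Field K] [AddCommGroup Γ] [LinearOrder Γ]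
    [IsOrderedAddMonoid Γ] (w : AddValuation K (WithTop Γ)) (a b : K) (γ δ : Γ)
    (hγ : γ < δ) :
    mval w a γ (X - C b) < mval w b δ (X - C b) := by
  have h1 : mval w a γ (X - C b) ≤ γ := by
    unfold mval
    refine (Finset.inf_le (b := 1) (by simp)).trans ?_
    simp
  refine h1.trans_lt ((WithTop.coe_lt_coe.2 hγ).trans_le ?_)
  unfold mval
  refine Finset.le_inf fun k hk => ?_
  have : k = 0 ∨ k = 1 := by
    simp at hk; omega
  rcases this with rfl | rfl <;> simp

/-- for a pseudo-Cauchy sequence `{a_i}` indexed by a well-ordered set with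
no greatest element, (a) `v(a_j − a_i)` is a constant `γ_i ∈ Γ` for `j > i`; (b) `{γ_i}` is
strictly increasing; (c) the monomial valuations `ν_i = v_{a_i, γ_i}` form a strictly
increasing chain of valuations on `K[x]`. -/
theorem stmt4 {K Γ : Type*} [Field K] [AddCommGroup Γ] [LinearOrder Γ] [IsOrderedAddMonoid Γ]
    (v : K → WithTop Γ) (hv : IsValdF v)
    {I : Type*} [LinearOrder I] [WellFoundedLT I] [Nonempty I]
    (hnomax : ∀ i : I, ∃ j : I, i < j)
    (a : I → K)
    (hpc : ∀ i j k : I, i < j → j < k → v (a i - a j) < v (a j - a k)) :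
    ∃ γ : I → Γ,
      (∀ i j : I, i < j → v (a j - a i) = (γ i : WithTop Γ)) ∧
      StrictMono γ ∧
      (∀ i j : I, i < j →
        (∀ f : Polynomial K, mval v (a i) (γ i) f ≤ mval v (a j) (γ j) f) ∧
        mval v (a i) (γ i) (X - C (a j)) < mval v (a j) (γ j) (X - C (a j))) := by
  have hw : ∀ x, hv.val x = v x := fun x => rfl
  have hconst : ∀ i j k : I, i < j → j < k → v (a k - a i) = v (a j - a i) := by
    intro i j k hij hjk
    have h := hpc i j k hij hjk
    rw [← hw, ← hw, AddValuation.map_sub_swap _ (a i) (a j), AddValuation.map_sub_swap _ (a j) (a k)] at h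
    rw [← hw, ← hw, show a k - a i = (a j - a i) + (a k - a j) by ring]
    exact AddValuation.map_add_eq_of_lt_left _ h
  have hγ : ∀ i : I, ∃ γ : Γ, ∀ j, i < j → v (a j - a i) = (γ : WithTop Γ) := by
    intro i
    obtain ⟨j, hij⟩ := hnomax i
    obtain ⟨k, hjk⟩ := hnomax j
    have h := hpc i j k hij hjk
    rw [← hw, AddValuation.map_sub_swap, hw] at h
    obtain ⟨γ, hγ⟩ := WithTop.ne_top_iff_exists.1 h.ne_top
    refine ⟨γ, fun l hl => ?_⟩
    rw [hγ]
    rcases lt_trichotomy l j with h | rfl | h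
    · exact (hconst i l j hl h).symm
    · rfl
    · exact hconst i j l hij h
  choose γ hγ using hγ
  have hmono : StrictMono γ := by
    intro i j hij
    obtain ⟨k, hjk⟩ := hnomax j
    have h := hpc i j k hij hjk
    rw [← hw, ← hw, AddValuation.map_sub_swap _ (a i) (a j), AddValuation.map_sub_swap _ (a j) (a k), hw, hw,
      hγ i j hij, hγ j k hjk] at h
    exact WithTop.coe_lt_coe.1 h
  refine ⟨γ, hγ, hmono, fun i j hij => ⟨fun f => ?_, ?_⟩⟩
  · exact mval_mono_aux hv.val (a i) (a j) _ _ (hγ i j hij) (hmono hij).le f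
  · exact mval_strict_aux hv.val (a i) (a j) _ _ (hmono hij)
end

section
/- Let Γ be a divisible linearly ordered abelian group and let (L, R) be a cut in Γ, i.e., L ∪ R = Γ, L ∩ R = ∅, and l < r for all l ∈ L, r ∈ R. Assume L is nonempty and has no maximum. Define a relation ≼ on ℤ × Γ by: (m, b) ≼ (n, a) if and only if there exists γ₀ ∈ L such that (m − n)·γ ≤ a − b for every γ ∈ L with γ ≥ γ₀. Then ≼ is a linear order on ℤ × Γ (reflexive, antisymmetric, transitive and total), it is compatible with the group structure (if (m, b) ≼ (n, a) then (m + t, b + c) ≼ (n + t, a + c) for all t ∈ ℤ, c ∈ Γ), and the element x := (1, 0) satisfies (0, b) ≼ x with (0, b) ≠ x for every b ∈ L, and x ≼ (0, a) with x ≠ (0, a) for every a ∈ R. -/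
/-- The order relation on `ℤ × Γ` associated to a cut `(L, R)` whose left set has no
maximum: `(m, b) ≼ (n, a)` iff `(m − n)·γ ≤ a − b` for all `γ` in some nonempty final
segment of `L`. -/
def cutRel {Γ : Type*} [AddCommGroup Γ] [LinearOrder Γ] [IsOrderedAddMonoid Γ] (L : Set Γ)
    (p q : ℤ × Γ) : Prop :=
  ∃ γ₀ ∈ L, ∀ γ ∈ L, γ₀ ≤ γ → (p.1 - q.1) • γ ≤ q.2 - p.2

theorem cutRel_total_aux {Γ : Type*} [AddCommGroup Γ] [LinearOrder Γ] [IsOrderedAddMonoid Γ]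
    (L : Set Γ) (hne : L.Nonempty) (p q : ℤ × Γ) (h : q.1 ≤ p.1) :
    cutRel L p q ∨ cutRel L q p := by
  by_cases hc : ∃ γ ∈ L, q.2 - p.2 ≤ (p.1 - q.1) • γ
  · obtain ⟨γ₀, h₀, hγ⟩ := hc
    refine Or.inr ⟨γ₀, h₀, fun γ _ hle => ?_⟩
    have h1 : (p.1 - q.1) • γ₀ ≤ (p.1 - q.1) • γ := zsmul_le_zsmul_right (by omega) hle
    have h2 := neg_le_neg (hγ.trans h1)
    rwa [← neg_zsmul, neg_sub, neg_sub] at h2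
  · push Not at hc
    obtain ⟨γ₀, h₀⟩ := hne
    exact Or.inl ⟨γ₀, h₀, fun γ hγ _ => (hc γ hγ).le⟩

/-- for a cut `(L, R)` in a divisible linearly ordered abelian group `Γ`
with `L` nonempty and without maximum, the relation `≼` on `ℤ × Γ` is a linear order
compatible with the group structure, and `x = (1, 0)` lies strictly between `L` and `R`. -/
theorem stmt5 {Γ : Type*} [AddCommGroup Γ] [LinearOrder Γ] [IsOrderedAddMonoid Γ]
    (hdiv : ∀ g : Γ, ∀ n : ℕ, 0 < n → ∃ h : Γ, n • h = g)
    (L R : Set Γ) (hunion : L ∪ R = Set.univ) (hdisj : L ∩ R = ∅)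
    (hLR : ∀ l ∈ L, ∀ r ∈ R, l < r)
    (hne : L.Nonempty) (hnomax : ∀ l ∈ L, ∃ l' ∈ L, l < l') :
    (∀ p : ℤ × Γ, cutRel L p p) ∧
    (∀ p q : ℤ × Γ, cutRel L p q → cutRel L q p → p = q) ∧
    (∀ p q r : ℤ × Γ, cutRel L p q → cutRel L q r → cutRel L p r) ∧
    (∀ p q : ℤ × Γ, cutRel L p q ∨ cutRel L q p) ∧
    (∀ p q : ℤ × Γ, ∀ t : ℤ, ∀ c : Γ, cutRel L p q →
      cutRel L (p.1 + t, p.2 + c) (q.1 + t, q.2 + c)) ∧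
    (∀ b ∈ L, cutRel L (0, b) (1, 0) ∧ ((0 : ℤ), b) ≠ ((1 : ℤ), (0 : Γ))) ∧
    (∀ a ∈ R, cutRel L (1, 0) (0, a) ∧ ((1 : ℤ), (0 : Γ)) ≠ ((0 : ℤ), a)) := by
  refine ⟨?_, ?_, ?_, ?_, ?_, ?_, ?_⟩
  · intro p
    obtain ⟨γ₀, h₀⟩ := hne
    exact ⟨γ₀, h₀, fun γ _ _ => by simp⟩
  · rintro p q ⟨g, hg, h1⟩ ⟨g', hg', h2⟩
    have key : ∀ γ ∈ L, max g g' ≤ γ → (p.1 - q.1) • γ = q.2 - p.2 := by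
      intro γ hγ hle
      apply le_antisymm (h1 γ hγ ((le_max_left _ _).trans hle))
      have h3 := neg_le_neg (h2 γ hγ ((le_max_right _ _).trans hle))
      rwa [← neg_zsmul, neg_sub, neg_sub] at h3
    have hm : max g g' ∈ L := by
      rcases max_choice g g' with h | h <;> rw [h] <;> assumption
    obtain ⟨l, hl, hlt⟩ := hnomax _ hm
    have e1 := key _ hm le_rfl
    have e2 := key l hl hlt.le
    have e3 : (p.1 - q.1) • (l - max g g') = 0 := by
      rw [zsmul_sub, e1, e2, sub_self]
    have e4 : p.1 - q.1 = 0 := by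
      rcases lt_trichotomy (p.1 - q.1) 0 with h | h | h
      · have := zsmul_pos (sub_pos.2 hlt) (neg_pos.2 h)
        rw [neg_zsmul, e3] at this
        simp at this
      · exact h
      · have := zsmul_pos (sub_pos.2 hlt) h
        rw [e3] at this
        simp at this
    rw [e4, zero_zsmul] at e1
    exact Prod.ext (sub_eq_zero.1 e4) (sub_eq_zero.1 e1.symm).symm
  · rintro p q r ⟨g, hg, h1⟩ ⟨g', hg', h2⟩
    have hm : max g g' ∈ L := by
      rcases max_choice g g' with h | h <;> rw [h] <;> assumption
    refine ⟨_, hm, fun γ hγ hle => ?_⟩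
    have h3 := add_le_add (h1 γ hγ ((le_max_left _ _).trans hle))
      (h2 γ hγ ((le_max_right _ _).trans hle))
    rw [← add_zsmul, sub_add_sub_cancel] at h3
    exact h3.trans_eq (by abel)
  · intro p q
    rcases le_total q.1 p.1 with h | h
    · exact cutRel_total_aux L hne p q h
    · exact (cutRel_total_aux L hne q p h).symm
  · rintro p q t c ⟨g, hg, h⟩
    refine ⟨g, hg, fun γ hγ hle => ?_⟩
    simpa using h γ hγ hle
  · intro b hb
    exact ⟨⟨b, hb, fun γ _ hle => by simpa using hle⟩, by simp⟩
  · intro a ha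
    obtain ⟨γ₀, h₀⟩ := hne
    exact ⟨⟨γ₀, h₀, fun γ hγ _ => by simpa using (hLR γ hγ a ha).le⟩, by simp⟩
end

section
/- Let Γ be a linearly ordered abelian group, n ≥ 1 an integer, β_1, …, β_n ∈ Γ, and let {γ_i}_{i∈I} be a strictly increasing family in Γ indexed by a nonempty totally ordered set I with no greatest element. If t_1, …, t_n are pairwise distinct positive integers, then there exist h with 1 ≤ h ≤ n and i₀ ∈ I such that β_l + t_l·γ_i > β_h + t_h·γ_i for every l with 1 ≤ l ≤ n, l ≠ h, and every i ∈ I with i > i₀. -/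
/-- Kaplansky's Lemma 4: given `β_1, …, β_n` in a linearly ordered abelian
group, a strictly increasing family `{γ_i}` without last element, and pairwise distinct
positive integers `t_1, …, t_n`, there is an index `h` whose term `β_h + t_h·γ_i` is
ultimately strictly smaller than all the others. -/
theorem stmt11 {Γ : Type*} [AddCommGroup Γ] [LinearOrder Γ] [IsOrderedAddMonoid Γ]
    (n : ℕ) (hn : 1 ≤ n) (β : Fin n → Γ)
    {I : Type*} [LinearOrder I] [Nonempty I]
    (γ : I → Γ) (hγ : StrictMono γ) (hnomax : ∀ i : I, ∃ j : I, i < j)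
    (t : Fin n → ℕ) (htpos : ∀ l : Fin n, 0 < t l) (htinj : Function.Injective t) :
    ∃ h : Fin n, ∃ i₀ : I, ∀ l : Fin n, l ≠ h → ∀ i : I, i₀ < i →
      β h + t h • γ i < β l + t l • γ i := by
  have key : ∀ a b : Fin n, t a < t b →
      (∃ i₀ : I, ∀ i, i₀ < i → β a + t a • γ i < β b + t b • γ i) ∨
      (∃ i₀ : I, ∀ i, i₀ < i → β b + t b • γ i < β a + t a • γ i) := by
    intro a b hab
    obtain ⟨k, hk⟩ := Nat.exists_eq_add_of_lt hab
    have hk' : t b = t a + (k + 1) := by omega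
    by_cases hex : ∃ i₁ : I, β a + t a • γ i₁ ≤ β b + t b • γ i₁
    · obtain ⟨i₁, h1⟩ := hex
      left
      refine ⟨i₁, fun i hi => ?_⟩
      have h2 : (k + 1) • γ i₁ < (k + 1) • γ i := nsmul_lt_nsmul_right (Nat.succ_ne_zero k) (hγ hi)
      rw [hk', add_nsmul] at h1 ⊢
      have h3 : β a ≤ β b + (k + 1) • γ i₁ := by
        rw [add_comm (t a • γ i₁), ← add_assoc] at h1
        exact le_of_add_le_add_right h1
      rw [add_comm (t a • γ i), ← add_assoc]
      gcongr
      exact h3.trans_lt (by gcongr)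
    · push Not at hex
      right
      exact ⟨Classical.arbitrary I, fun i _ => hex i⟩
  have key2 : ∀ a b : Fin n, a ≠ b →
      (∃ i₀ : I, ∀ i, i₀ < i → β a + t a • γ i < β b + t b • γ i) ∨
      (∃ i₀ : I, ∀ i, i₀ < i → β b + t b • γ i < β a + t a • γ i) := by
    intro a b hab
    rcases lt_or_gt_of_ne (fun h => hab (htinj h)) with h | h
    · exact key a b h
    · exact (key b a h).symm
  have main : ∀ s : Finset (Fin n), s.Nonempty → ∃ h ∈ s, ∃ i₀ : I, ∀ l ∈ s, l ≠ h →
      ∀ i : I, i₀ < i → β h + t h • γ i < β l + t l • γ i := by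
    intro s hs
    induction hs using Finset.Nonempty.cons_induction with
    | singleton a =>
      refine ⟨a, by simp, Classical.arbitrary I, fun l hl hla => ?_⟩
      exact absurd (Finset.mem_singleton.1 hl) hla
    | cons a s ha hs ih =>
      obtain ⟨h, hhs, i₀, H⟩ := ih
      have hah : a ≠ h := fun e => ha (e ▸ hhs)
      rcases key2 a h hah with ⟨i₁, h1⟩ | ⟨i₁, h1⟩
      · refine ⟨a, by simp, max i₀ i₁, fun l hl hla i hi => ?_⟩
        obtain ⟨hi0, hi1⟩ := max_lt_iff.1 hi
        rcases Finset.mem_cons.1 hl with e | hls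
        · exact absurd e hla
        · by_cases e : l = h
          · rw [e]; exact h1 i hi1
          · exact (h1 i hi1).trans (H l hls e i hi0)
      · refine ⟨h, by simp [hhs], max i₀ i₁, fun l hl hla i hi => ?_⟩
        obtain ⟨hi0, hi1⟩ := max_lt_iff.1 hi
        rcases Finset.mem_cons.1 hl with e | hls
        · rw [e]; exact h1 i hi1
        · exact H l hls hla i hi0
  obtain ⟨h, -, i₀, H⟩ := main Finset.univ ⟨⟨0, hn⟩, Finset.mem_univ _⟩
  exact ⟨h, i₀, fun l => H l (Finset.mem_univ l)⟩
end

section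
/- Let (K, v) be a valued field, {a_i}_{i∈I} a pseudo-Cauchy sequence in K indexed by a well-ordered set I with no greatest element, and f ∈ K[x] a nonconstant polynomial. Then {f(a_i)}_{i∈I} is ultimately a pseudo-Cauchy sequence, i.e., there exists i₀ ∈ I such that {f(a_i)}_{i ≥ i₀} is a pseudo-Cauchy sequence. -/
open Polynomial

lemma exists_min_of_total {α : Type*} (R : α → α → Prop) (htr : ∀ x y z, R x y → R y z → R x z)
    (S : Finset α) (hS : S.Nonempty) (htot : ∀ x ∈ S, ∀ y ∈ S, x ≠ y → R x y ∨ R y x) :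
    ∃ x ∈ S, ∀ y ∈ S, y ≠ x → R x y := by
  classical
  induction hS using Finset.Nonempty.cons_induction with
  | singleton b => exact ⟨b, by simp, by simp⟩
  | cons b s hb hs ih =>
    obtain ⟨x, hx, hmin⟩ := ih (fun x hx y hy => htot x (by simp [hx]) y (by simp [hy]))
    have hxb : x ≠ b := fun h => hb (h ▸ hx)
    rcases htot x (by simp [hx]) b (by simp) hxb with h | h
    · refine ⟨x, by simp [hx], fun y hy hyx => ?_⟩
      rcases Finset.mem_cons.1 hy with rfl | hy
      · exact h
      · exact hmin y hy hyx
    · refine ⟨b, by simp, fun y hy hyx => ?_⟩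
      rcases Finset.mem_cons.1 hy with rfl | hy
      · exact absurd rfl hyx
      · by_cases hyx' : y = x
        · exact hyx' ▸ h
        · exact htr _ _ _ h (hmin y hy hyx')

lemma arith_aux {Γ : Type*} [AddCommGroup Γ] [LinearOrder Γ] [IsOrderedAddMonoid Γ]
    (b c x y : WithTop Γ) (n m : ℕ) (hnm : n < m) (hb : b ≠ ⊤) (hc : c ≠ ⊤) (hy : y ≠ ⊤)
    (hxy : x < y) (h : b + n • x ≤ c + m • x) : b + n • y < c + m • y := by
  have hx : x ≠ ⊤ := hxy.ne_top
  lift b to Γ using hb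
  lift c to Γ using hc
  lift x to Γ using hx
  lift y to Γ using hy
  norm_cast at *
  obtain ⟨d, rfl⟩ := Nat.exists_eq_add_of_lt hnm
  have h1 : (d + 1) • x < (d + 1) • y := nsmul_lt_nsmul_right (Nat.succ_ne_zero d) hxy
  rw [add_assoc n, add_nsmul] at h ⊢
  have h2 : b ≤ c + (d + 1) • x := by
    rw [add_left_comm, add_comm b] at h
    exact le_of_add_le_add_left h
  rw [add_left_comm, add_comm b]
  exact add_lt_add_right (h2.trans_lt (add_lt_add_right h1 c)) _

lemma arith_aux2 {Γ : Type*} [AddCommGroup Γ] [LinearOrder Γ] [IsOrderedAddMonoid Γ]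
    (b x y : WithTop Γ) (n : ℕ) (hn : n ≠ 0) (hb : b ≠ ⊤) (hy : y ≠ ⊤)
    (hxy : x < y) : b + n • x < b + n • y := by
  have hx : x ≠ ⊤ := hxy.ne_top
  lift b to Γ using hb
  lift x to Γ using hx
  lift y to Γ using hy
  norm_cast at *
  exact add_lt_add_right (nsmul_lt_nsmul_right hn hxy) _

lemma stmt12_aux {K Γ : Type*} [Field K] [AddCommGroup Γ] [LinearOrder Γ] [IsOrderedAddMonoid Γ]
    (v : AddValuation K (WithTop Γ))
    {I : Type*} [LinearOrder I] [Nonempty I]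
    (hnomax : ∀ i : I, ∃ j : I, i < j)
    (a : I → K)
    (hpc : ∀ i j k : I, i < j → j < k → v (a i - a j) < v (a j - a k))
    (f : Polynomial K) (hf : 0 < f.degree) :
    ∃ i₀ : I, ∀ i j k : I, i₀ ≤ i → i < j → j < k →
      v (f.eval (a i) - f.eval (a j)) < v (f.eval (a j) - f.eval (a k)) := by
  classical
  let U : Ultrafilter I := Ultrafilter.of Filter.atTop
  have hU : (U : Filter I) ≤ Filter.atTop := Ultrafilter.of_le _
  have : NoMaxOrder I := ⟨hnomax⟩
  have hgt : ∀ i : I, ∀ᶠ j in (U : Filter I), i < j := fun i => hU (Filter.eventually_gt_atTop i)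
  -- `w` facts
  have hfin : ∀ i j : I, i < j → v (a i - a j) ≠ ⊤ := by
    intro i j hij
    obtain ⟨k, hk⟩ := hnomax j
    exact (hpc i j k hij hk).ne_top
  have hw : ∀ i i' j : I, i < i' → i' < j → v (a i - a j) < v (a i' - a j) := by
    intro i i' j h1 h2
    have h := hpc i i' j h1 h2
    have e : a i - a j = (a i - a i') + (a i' - a j) := by ring
    rw [e, AddValuation.map_add_eq_of_lt_left v h]
    exact h
  let c : ℕ → I → K := fun n j => (taylor (a j) f).coeff n
  let t : ℕ → I → I → WithTop Γ := fun n i j => v (c n j) + n • v (a i - a j)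
  have ht : ∀ n i j, v (c n j * (a i - a j) ^ n) = t n i j := by
    intro n i j
    simp [t, AddValuation.map_mul, AddValuation.map_pow]
  have hexp : ∀ i j, f.eval (a i) - f.eval (a j) =
      ∑ n ∈ Finset.Icc 1 f.natDegree, c n j * (a i - a j) ^ n := by
    intro i j
    have h1 : f.eval (a i) = (taylor (a j) f).eval (a i - a j) := by
      rw [taylor_eval]; simp
    rw [h1, eval_eq_sum_range, natDegree_taylor, Finset.sum_range_succ']
    simp only [taylor_coeff_zero, pow_zero, mul_one, add_sub_cancel_right]
    rw [Finset.range_eq_Ico, Finset.sum_Ico_add' (fun n => c n j * (a i - a j) ^ n) 0 f.natDegree 1]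
    rfl
  let S : Finset ℕ := (Finset.Icc 1 f.natDegree).filter
    (fun n => ∀ᶠ j in (U : Filter I), c n j ≠ 0)
  have hdeg : 0 < f.natDegree := natDegree_pos_iff_degree_pos.2 hf
  have hSne : S.Nonempty := by
    refine ⟨f.natDegree, ?_⟩
    simp only [S, Finset.mem_filter, Finset.mem_Icc]
    refine ⟨⟨hdeg, le_rfl⟩, Filter.Eventually.of_forall fun j => ?_⟩
    have h0 : taylor (a j) f ≠ 0 := by
      intro h
      have := natDegree_taylor f (a j)
      rw [h] at this
      simp at this
      omega
    have := leadingCoeff_ne_zero.2 h0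
    rwa [leadingCoeff, natDegree_taylor] at this
  let R : ℕ → ℕ → Prop := fun n m =>
    ∀ᶠ i in (Filter.atTop : Filter I), ∀ᶠ j in (U : Filter I), t n i j < t m i j
  have hlt : ∀ n ∈ S, ∀ m ∈ S, n < m → R n m ∨ R m n := by
    intro n hn m hm hnm
    have hn' := (Finset.mem_filter.1 hn).2
    have hm' := (Finset.mem_filter.1 hm).2
    by_cases h : ∃ i, ∀ᶠ j in (U : Filter I), t n i j ≤ t m i j
    · left
      obtain ⟨i, hi⟩ := h
      filter_upwards [Filter.eventually_gt_atTop i] with i' hi'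
      filter_upwards [hi, hn', hm', hgt i'] with j h1 h2 h3 h4
      exact arith_aux _ _ _ _ n m hnm (by simpa using h2) (by simpa using h3) (hfin i' j h4)
        (hw i i' j hi' h4) h1
    · right
      push Not at h
      refine Filter.Eventually.of_forall fun i => ?_
      exact h i
  obtain ⟨n, hnS, hmin⟩ := exists_min_of_total R
    (fun x y z h1 h2 => by
      filter_upwards [h1, h2] with i h1 h2
      filter_upwards [h1, h2] with j h1 h2 using h1.trans h2) S hSne
    (fun x hx y hy hxy => by
      rcases lt_or_gt_of_ne hxy with h | h
      · exact hlt x hx y hy h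
      · exact (hlt y hy x hx h).symm)
  have hnI := (Finset.mem_filter.1 hnS).1
  have hn0 : n ≠ 0 := by have := (Finset.mem_Icc.1 hnI).1; omega
  have hnc := (Finset.mem_filter.1 hnS).2
  have hall : ∀ᶠ i in (Filter.atTop : Filter I), ∀ m ∈ S, m ≠ n →
      ∀ᶠ j in (U : Filter I), t n i j < t m i j := by
    rw [Filter.eventually_all_finset]
    intro m hm
    by_cases h : m = n
    · simp [h]
    · filter_upwards [hmin m hm h] with i hi _ using hi
  obtain ⟨i₀, hi₀⟩ := Filter.eventually_atTop.1 hall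
  have hval : ∀ i, i₀ ≤ i → ∀ᶠ j in (U : Filter I),
      v (f.eval (a i) - f.eval (a j)) = t n i j := by
    intro i hi
    have h1 : ∀ᶠ j in (U : Filter I), ∀ m ∈ Finset.Icc 1 f.natDegree, m ≠ n →
        t n i j < v (c m j * (a i - a j) ^ m) := by
      rw [Filter.eventually_all_finset]
      intro m hm
      by_cases hmn : m = n
      · simp [hmn]
      by_cases hmS : m ∈ S
      · filter_upwards [hi₀ i hi m hmS hmn] with j hj _
        rw [ht]; exact hj
      · have : ¬ ∀ᶠ j in (U : Filter I), c m j ≠ 0 := fun h => hmS (Finset.mem_filter.2 ⟨hm, h⟩)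
        rw [← Ultrafilter.eventually_not] at this
        filter_upwards [this, hnc, hgt i] with j hj hc hij _
        have hj : c m j = 0 := not_not.1 hj
        rw [hj, zero_mul, AddValuation.map_zero, ← ht, lt_top_iff_ne_top, AddValuation.ne_top_iff]
        exact mul_ne_zero hc (pow_ne_zero _ ((AddValuation.ne_top_iff v).1 (hfin i j hij)))
    filter_upwards [h1, hnc, hgt i] with j hj hc hij
    rw [hexp, ← Finset.add_sum_erase _ _ hnI, ← ht]
    apply AddValuation.map_add_eq_of_lt_left
    apply AddValuation.map_lt_sum
    · rw [AddValuation.ne_top_iff]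
      exact mul_ne_zero hc (pow_ne_zero _ ((AddValuation.ne_top_iff v).1 (hfin i j hij)))
    · intro m hm
      rw [ht]
      exact hj m (Finset.mem_of_mem_erase hm) (Finset.ne_of_mem_erase hm)
  refine ⟨i₀, fun i j k hi hij hjk => ?_⟩
  obtain ⟨l, hli, hlj, hlk, hc, hkl⟩ := ((hval i hi).and ((hval j (hi.trans hij.le)).and
    ((hval k (hi.trans (hij.trans hjk).le)).and (hnc.and (hgt k))))).exists
  have hjl := hjk.trans hkl
  have h1 : t n i l < t n j l := arith_aux2 _ _ _ n hn0 (by simpa using hc) (hfin j l hjl)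
    (hw i j l hij hjl)
  have h2 : t n j l < t n k l := arith_aux2 _ _ _ n hn0 (by simpa using hc) (hfin k l hkl)
    (hw j k l hjk hkl)
  have key : ∀ x y z : K, v (x - z) < v (y - z) → v (x - y) = v (x - z) := by
    intro x y z h
    have e : x - y = (x - z) + (z - y) := by ring
    rw [e]
    apply AddValuation.map_add_eq_of_lt_left
    rwa [AddValuation.map_sub_swap v z y]
  rw [key (f.eval (a i)) (f.eval (a j)) (f.eval (a l)) (by rw [hli, hlj]; exact h1),
    key (f.eval (a j)) (f.eval (a k)) (f.eval (a l)) (by rw [hlj, hlk]; exact h2), hli, hlj]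
  exact h1

/-- the image of a pseudo-Cauchy sequence under a nonconstant polynomial is
ultimately a pseudo-Cauchy sequence. -/
theorem stmt12 {K Γ : Type*} [Field K] [AddCommGroup Γ] [LinearOrder Γ] [IsOrderedAddMonoid Γ]
    (v : K → WithTop Γ) (hv : IsValdF v)
    {I : Type*} [LinearOrder I] [WellFoundedLT I] [Nonempty I]
    (hnomax : ∀ i : I, ∃ j : I, i < j)
    (a : I → K)
    (hpc : ∀ i j k : I, i < j → j < k → v (a i - a j) < v (a j - a k))
    (f : Polynomial K) (hf : 0 < f.degree) :
    ∃ i₀ : I, ∀ i j k : I, i₀ ≤ i → i < j → j < k →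
      v (f.eval (a i) - f.eval (a j)) < v (f.eval (a j) - f.eval (a k)) := by
  obtain ⟨hmul, hadd, htop⟩ := hv
  have h1 : v 1 = 0 := by
    have h := hmul 1 1
    have h' : v 1 ≠ ⊤ := fun h => one_ne_zero ((htop 1).1 h)
    rw [mul_one] at h
    lift v 1 to Γ using h' with g
    norm_cast at *
    simpa using h
  exact stmt12_aux (AddValuation.of v ((htop 0).2 rfl) h1 hadd hmul) hnomax a hpc f hf
end

section
/- Let (K, v) be a valued field and {a_i}_{i∈I} a pseudo-Cauchy sequence in K indexed by a well-ordered set I with no greatest element. For i ∈ I, let γ_i be the common value v(a_j − a_i) for j > i, and let ν_i = v_{a_i, γ_i} be the corresponding monomial valuation on K[x]. Let g ∈ K[x] be a nonzero polynomial such that every nonzero polynomial of degree strictly smaller than deg g is fixed by {a_i}. Then there exists i₀ ∈ I such that v(g(a_i)) = ν_i(g) for every i ∈ I with i ≥ i₀. -/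
open Polynomial

/-- A polynomial `f` is fixed by the sequence `{a_i}` if the values `v(f(a_i))` are
ultimately constant. -/
def PCFixed {K Γ I : Type*} [Field K] [AddCommGroup Γ] [LinearOrder Γ] [IsOrderedAddMonoid Γ] [LinearOrder I]
    (v : K → WithTop Γ) (a : I → K) (f : Polynomial K) : Prop :=
  ∃ i₀ : I, ∀ i : I, i₀ ≤ i → v (f.eval (a i)) = v (f.eval (a i₀))

theorem exists_strict_min {P : ℕ → ℕ → Prop} (htr : ∀ a b c, P a b → P b c → P a c)
    (s : Finset ℕ) (hs : s.Nonempty) (htot : ∀ a ∈ s, ∀ b ∈ s, a ≠ b → P a b ∨ P b a) :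
    ∃ k ∈ s, ∀ l ∈ s, l ≠ k → P k l := by
  induction hs using Finset.Nonempty.cons_induction with
  | singleton a => exact ⟨a, by simp, by simp⟩
  | cons a s ha hs ih =>
    obtain ⟨k, hk, hkl⟩ := ih (fun x hx y hy => htot x (by simp [hx]) y (by simp [hy]))
    have hne : a ≠ k := fun h => ha (h ▸ hk)
    rcases htot a (by simp) k (by simp [hk]) hne with h | h
    · refine ⟨a, by simp, fun l hl hla => ?_⟩
      rcases Finset.mem_cons.1 hl with rfl | hl
      · exact absurd rfl hla
      · by_cases hlk : l = k
        · exact hlk ▸ h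
        · exact htr _ _ _ h (hkl l hl hlk)
    · refine ⟨k, by simp [hk], fun l hl hlk => ?_⟩
      rcases Finset.mem_cons.1 hl with rfl | hl
      · exact h
      · exact hkl l hl hlk

theorem lines_compare {Γ I : Type*} [AddCommGroup Γ] [LinearOrder Γ] [IsOrderedAddMonoid Γ]
    [LinearOrder I] [Nonempty I] (hnomax : ∀ i : I, ∃ j : I, i < j) (γ : I → Γ)
    (hm : StrictMono γ) (b c : Γ) (k l : ℕ) (hkl : k < l) :
    (∀ᶠ i in Filter.atTop, b + k • γ i < c + l • γ i) ∨
    (∀ᶠ i in Filter.atTop, c + l • γ i < b + k • γ i) := by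
  obtain ⟨d, rfl⟩ := Nat.exists_eq_add_of_lt hkl
  have key : ∀ i, k • γ i + (d + 1) • γ i = (k + d + 1) • γ i := fun i => by
    rw [← add_smul, add_assoc]
  by_cases h : ∃ i, b ≤ c + (d + 1) • γ i
  · left
    obtain ⟨i, hi⟩ := h
    obtain ⟨j, hj⟩ := hnomax i
    filter_upwards [Filter.eventually_ge_atTop j] with m hmj
    have h1 : (d + 1) • γ i < (d + 1) • γ m :=
      nsmul_lt_nsmul_right (by omega) (hm (lt_of_lt_of_le hj hmj))
    rw [← key, add_comm (k • γ m), ← add_assoc]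
    gcongr
    exact hi.trans_lt (by gcongr)
  · right
    push Not at h
    refine Filter.Eventually.of_forall fun m => ?_
    rw [← key, add_comm (k • γ m), ← add_assoc]
    have := h m
    gcongr

/-- if every nonzero polynomial of degree smaller than `deg g` is fixed by
the pseudo-Cauchy sequence `{a_i}`, then ultimately `v(g(a_i)) = ν_i(g)` where
`ν_i = v_{a_i, γ_i}`. -/
theorem stmt14 {K Γ : Type*} [Field K] [AddCommGroup Γ] [LinearOrder Γ] [IsOrderedAddMonoid Γ]
    (v : K → WithTop Γ) (hv : IsValdF v)
    {I : Type*} [LinearOrder I] [WellFoundedLT I] [Nonempty I]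
    (hnomax : ∀ i : I, ∃ j : I, i < j)
    (a : I → K)
    (hpc : ∀ i j k : I, i < j → j < k → v (a i - a j) < v (a j - a k))
    (γ : I → Γ) (hγ : ∀ i j : I, i < j → v (a j - a i) = (γ i : WithTop Γ))
    (g : Polynomial K) (hg : g ≠ 0)
    (hsmall : ∀ h : Polynomial K, h ≠ 0 → h.degree < g.degree → PCFixed v a h) :
    ∃ i₀ : I, ∀ i : I, i₀ ≤ i → v (g.eval (a i)) = mval v (a i) (γ i) g := by
  classical
  obtain ⟨hmul, hadd, htop⟩ := hv
  have hv0 : v 0 = ⊤ := (htop 0).2 rfl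
  have hv1 : v 1 = 0 := by
    have h := hmul 1 1
    have h1 : v 1 ≠ ⊤ := fun h => one_ne_zero ((htop 1).1 h)
    lift v 1 to Γ using h1 with x hx
    rw [mul_one, ← hx] at h
    norm_cast at h ⊢
    simpa using h
  let w : AddValuation K (WithTop Γ) := AddValuation.of v hv0 hv1 hadd hmul
  have hw : ∀ x, v x = w x := fun x => rfl
  have hm : StrictMono γ := by
    intro i j hij
    obtain ⟨k, hk⟩ := hnomax j
    have h := hpc i j k hij hk
    rw [hw, hw, w.map_sub_swap (a i), w.map_sub_swap (a j) (a k), ← hw, ← hw, hγ _ _ hij, hγ _ _ hk] at h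
    exact_mod_cast h
  set N := g.natDegree with hN
  set c : ℕ → I → K := fun k i => (taylor (a i) g).coeff k with hc
  have hc0 : ∀ i, c 0 i = g.eval (a i) := fun i => taylor_coeff_zero _ _
  have hcN : ∀ i, c N i = g.leadingCoeff := fun i => by
    simp only [hc]
    exact coeff_taylor_natDegree ..
  have hexp : ∀ i j, g.eval (a j) = ∑ l ∈ Finset.range (N + 1), c l i * (a j - a i) ^ l := by
    intro i j
    have h : (taylor (a i) g).eval (a j - a i) = g.eval (a j) := by
      rw [taylor_eval]; congr 1; ring
    rw [← h, eval_eq_sum_range, natDegree_taylor]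
  have hβ : ∀ k, 1 ≤ k → ∃ β : WithTop Γ, ∀ᶠ i in Filter.atTop, v (c k i) = β := by
    intro k hk
    by_cases h0 : hasseDeriv k g = 0
    · refine ⟨⊤, Filter.Eventually.of_forall fun i => ?_⟩
      simp only [hc, taylor_coeff, h0, eval_zero, hv0]
    · have hd : (hasseDeriv k g).degree < g.degree := by
        apply degree_lt_degree
        have h1 := natDegree_hasseDeriv_le g k
        by_contra hcon
        have : g.natDegree = 0 := by omega
        exact h0 (hasseDeriv_eq_zero_of_lt_natDegree g k (by omega))
      obtain ⟨i₀, hi₀⟩ := hsmall _ h0 hd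
      refine ⟨v (eval (a i₀) (hasseDeriv k g)), ?_⟩
      · filter_upwards [Filter.eventually_ge_atTop i₀] with i hi
        simp only [hc, taylor_coeff]
        exact hi₀ i hi
  choose! β hβ using hβ
  by_cases hN0 : N = 0
  · obtain ⟨i⟩ := ‹Nonempty I›
    refine ⟨i, fun i _ => ?_⟩
    simp only [mval, ← hN, hN0]
    simp [taylor_coeff_zero]
  have hβN : β N ≠ ⊤ := by
    obtain ⟨i, hi⟩ := (hβ N (by omega)).exists
    rw [← hi, hcN]
    exact fun h => hg (leadingCoeff_eq_zero.1 ((htop _).1 h))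
  set B : ℕ → I → WithTop Γ := fun k i => β k + ((k • γ i : Γ) : WithTop Γ) with hB
  obtain ⟨k, hks, hkmin⟩ := exists_strict_min
    (P := fun k l => ∀ᶠ i in Filter.atTop, B k i < B l i)
    (fun x y z h1 h2 => by filter_upwards [h1, h2] with i h1 h2 using h1.trans h2)
    ((Finset.Icc 1 N).filter fun l => β l ≠ ⊤)
    ⟨N, by simp [hβN]; omega⟩
    (by
      intro x hx y hy hxy
      simp only [Finset.mem_filter] at hx hy
      obtain ⟨bx, hbx⟩ := WithTop.ne_top_iff_exists.1 hx.2
      obtain ⟨b', hb'⟩ := WithTop.ne_top_iff_exists.1 hy.2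
      simp only [hB, ← hbx, ← hb']
      norm_cast
      rcases lt_or_gt_of_ne hxy with h | h
      · exact lines_compare hnomax γ hm _ _ _ _ h
      · exact (lines_compare hnomax γ hm _ _ _ _ h).symm)
  simp only [Finset.mem_filter, Finset.mem_Icc] at hks
  obtain ⟨⟨hk1, hkN⟩, hkt⟩ := hks
  have hBtop : ∀ i, B k i < ⊤ := fun i => by
    simp only [hB]
    exact WithTop.add_lt_top.2 ⟨lt_top_iff_ne_top.2 hkt, WithTop.coe_lt_top _⟩
  have hmin : ∀ᶠ i in Filter.atTop, ∀ l ∈ Finset.Icc 1 N, l ≠ k → B k i < B l i := by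
    rw [Filter.eventually_all_finset]
    intro l hl
    by_cases hlk : l = k
    · simp [hlk]
    by_cases hlt : β l = ⊤
    · refine Filter.Eventually.of_forall fun i _ => ?_
      have : B l i = ⊤ := by simp [hB, hlt]
      rw [this]; exact hBtop i
    · filter_upwards [hkmin l (by simpa [hlt] using hl) hlk] with i hi _ using hi
  have hval : ∀ᶠ i in Filter.atTop, ∀ l ∈ Finset.Icc 1 N, v (c l i) = β l := by
    rw [Filter.eventually_all_finset]
    intro l hl
    exact hβ l (Finset.mem_Icc.1 hl).1
  obtain ⟨i₁, hi₁⟩ := Filter.eventually_atTop.1 (hmin.and hval)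
  have hpow : ∀ i j, i < j → ∀ l : ℕ, v ((a j - a i) ^ l) = ((l • γ i : Γ) : WithTop Γ) := by
    intro i j hij l
    rw [hw, w.map_pow, ← hw, hγ i j hij]
    norm_cast
  have hdiff : ∀ i j, i₁ ≤ i → i < j → v (g.eval (a j) - g.eval (a i)) = B k i := by
    intro i j hi hij
    obtain ⟨h1, h2⟩ := hi₁ i hi
    have hterm : ∀ l ∈ Finset.Icc 1 N, v (c l i * (a j - a i) ^ l) = B l i := by
      intro l hl
      rw [hmul, h2 l hl, hpow i j hij]
    have hkm : k ∈ Finset.Icc 1 N := Finset.mem_Icc.2 ⟨hk1, hkN⟩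
    have he : g.eval (a j) - g.eval (a i) = c k i * (a j - a i) ^ k
        + ∑ l ∈ (Finset.Icc 1 N).erase k, c l i * (a j - a i) ^ l := by
      rw [Finset.add_sum_erase _ (fun l => c l i * (a j - a i) ^ l) hkm, hexp i j,
        Finset.sum_range_eq_add_Ico _ (by omega), hc0]
      simp only [pow_zero, mul_one, add_sub_cancel_left]
      rfl
    have hlt : w (c k i * (a j - a i) ^ k)
        < w (∑ l ∈ (Finset.Icc 1 N).erase k, c l i * (a j - a i) ^ l) := by
      rw [← hw, hterm k hkm]
      refine w.map_lt_sum (hBtop i).ne fun l hl => ?_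
      rw [Finset.mem_erase] at hl
      rw [← hw, hterm l hl.2]
      exact h1 l hl.2 hl.1
    rw [he, hw, w.map_add_eq_of_lt_left hlt, ← hw, hterm k hkm]
  -- enough to bound by the dominating line
  have hfin : ∀ i, i₁ ≤ i → v (g.eval (a i)) ≤ B k i →
      v (g.eval (a i)) = mval v (a i) (γ i) g := by
    intro i hi hle
    obtain ⟨h1, h2⟩ := hi₁ i hi
    apply le_antisymm
    · refine Finset.le_inf fun l hl => ?_
      rcases Nat.eq_zero_or_pos l with rfl | hl0
      · simp [taylor_coeff_zero]
      · have hlm : l ∈ Finset.Icc 1 N := by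
          simp only [Finset.mem_range] at hl
          exact Finset.mem_Icc.2 ⟨hl0, by omega⟩
        have h3 : v ((taylor (a i) g).coeff l) = β l := h2 l hlm
        rw [h3]
        by_cases hlk : l = k
        · subst hlk; exact hle
        · exact hle.trans (h1 l hlm hlk).le
    · refine (Finset.inf_le (b := 0) (by simp)).trans ?_
      simp [taylor_coeff_zero]
  by_cases hall : ∀ i, i₁ ≤ i → v (g.eval (a i)) ≤ B k i
  · exact ⟨i₁, fun i hi => hfin i hi (hall i hi)⟩
  · push Not at hall
    obtain ⟨i, hi, hlt⟩ := hall
    obtain ⟨j₀, hj₀⟩ := hnomax i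
    refine ⟨j₀, fun j hj => ?_⟩
    have hij : i < j := lt_of_lt_of_le hj₀ hj
    refine hfin j (hi.trans hij.le) ?_
    have hd := hdiff i j hi hij
    have : v (g.eval (a j)) = B k i := by
      rw [← hd, hw, hw, ← w.map_add_eq_of_lt_left (x := g.eval (a j) - g.eval (a i))
        (y := g.eval (a i)) (by rw [← hw, ← hw, hd]; exact hlt), sub_add_cancel]
    rw [this]
    simp only [hB]
    gcongr
    exact WithTop.coe_le_coe.2 (nsmul_le_nsmul_right (hm hij).le k)
end

section
/- Let (K, v) be a valued field and {a_i}_{i∈I} a pseudo-Cauchy sequence of transcendental type in K indexed by a well-ordered set I with no greatest element, i.e., every polynomial f ∈ K[x] is fixed by {a_i}; let ν_a(f) denote the eventual value of {v(f(a_i))}_{i∈I}. For i ∈ I, let γ_i be the common value v(a_j − a_i) for j > i and ν_i = v_{a_i, γ_i}. Then: (1) ν_a is a valuation on K[x] extending v; (2) ν_i(f) ≤ ν_a(f) for every i ∈ I and f ∈ K[x]; (3) for every linearly ordered abelian group Λ containing Γ as an ordered subgroup and every valuation μ on K[x] with values in Λ ∪ {∞} extending v such that ν_i(f) ≤ μ(f)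 for all i ∈ I and f ∈ K[x], one has ν_a(f) ≤ μ(f) for every f ∈ K[x]. In other words, ν_a is the supremum of the family {ν_i}_{i∈I}. -/
open Polynomial

/-- The bundled additive valuation attached to `hv`. -/
theorem aux_exists_addValuation {K Γ : Type*} [Field K] [AddCommGroup Γ] [LinearOrder Γ]
    [IsOrderedAddMonoid Γ] (v : K → WithTop Γ) (hv : IsValdF v) :
    ∃ V : AddValuation K (WithTop Γ), ∀ x, V x = v x := by
  obtain ⟨hmul, hadd, htop⟩ := hv
  have h1 : v 1 = 0 := by
    have h := hmul 1 1
    have hne : v 1 ≠ ⊤ := fun h => one_ne_zero ((htop 1).1 h)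
    rw [mul_one] at h
    lift v 1 to Γ using hne with g
    norm_cast at h ⊢
    simpa using h
  exact ⟨AddValuation.of v ((htop 0).2 rfl) h1 hadd hmul, fun x => rfl⟩

/-- Terms with pairwise distinct values: the value of the sum is the minimum. -/
theorem aux_sum_distinct {K Γ : Type*} [Field K] [AddCommGroup Γ] [LinearOrder Γ]
    [IsOrderedAddMonoid Γ] (V : AddValuation K (WithTop Γ)) (t : ℕ → K) (s : Finset ℕ)
    (h : ∀ i ∈ s, ∀ j ∈ s, i ≠ j → V (t i) = V (t j) → V (t i) = ⊤) :
    V (∑ i ∈ s, t i) = s.inf fun i => V (t i) := by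
  classical
  induction s using Finset.induction_on with
  | empty => simp
  | insert n s hn ih =>
    have ih' := ih fun i hi j hj => h i (Finset.mem_insert_of_mem hi) j (Finset.mem_insert_of_mem hj)
    rw [Finset.sum_insert hn, Finset.inf_insert, ← ih']
    by_cases hne : V (t n) = V (∑ i ∈ s, t i)
    · have htop : V (t n) = ⊤ := by
        rcases s.eq_empty_or_nonempty with rfl | hs
        · simpa using hne
        · obtain ⟨j, hj, hje⟩ := Finset.exists_mem_eq_inf s hs fun i => V (t i)
          rw [ih', hje] at hne
          exact h n (Finset.mem_insert_self _ _) j (Finset.mem_insert_of_mem hj)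
            (fun e => hn (e ▸ hj)) hne
      have h2 : V (∑ i ∈ s, t i) = ⊤ := hne ▸ htop
      rw [htop, h2]
      have h3 := V.map_add (t n) (∑ i ∈ s, t i)
      rw [htop, h2] at h3
      simpa using h3
    · exact V.map_add_of_distinct_val hne

/-- Two lines of different slopes meet at most once. -/
theorem aux_lines {Γ : Type*} [AddCommGroup Γ] [LinearOrder Γ] [IsOrderedAddMonoid Γ]
    (b c g g' : Γ) (j k : ℕ) (hjk : j < k) (hg : g < g') (h : b + j • g = c + k • g) :
    b + j • g' ≠ c + k • g' := by
  intro h'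
  obtain ⟨d, rfl⟩ := Nat.exists_eq_add_of_lt hjk
  have h1 : (d + 1) • g < (d + 1) • g' := nsmul_lt_nsmul_right (by omega) hg
  rw [add_assoc, add_nsmul, add_left_comm, add_comm b, add_right_inj] at h h'
  have := add_left_cancel (h.symm.trans h')
  exact h1.ne this

/-- for a pseudo-Cauchy sequence of transcendental type (every polynomial
is fixed, with eventual value `w`), the map `w` is a valuation on `K[x]` extending `v`,
it dominates every `ν_i = v_{a_i,γ_i}`, and it is the supremum of the family `{ν_i}`:
any valuation `μ` (with values in any ordered abelian group `Λ` containing `Γ` via a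
strictly monotone embedding `e`) extending `v` and dominating every `ν_i` dominates `w`. -/
theorem stmt16 {K Γ : Type*} [Field K] [AddCommGroup Γ] [LinearOrder Γ] [IsOrderedAddMonoid Γ]
    (v : K → WithTop Γ) (hv : IsValdF v)
    {I : Type*} [LinearOrder I] [WellFoundedLT I] [Nonempty I]
    (hnomax : ∀ i : I, ∃ j : I, i < j)
    (a : I → K)
    (hpc : ∀ i j k : I, i < j → j < k → v (a i - a j) < v (a j - a k))
    (γ : I → Γ) (hγ : ∀ i j : I, i < j → v (a j - a i) = (γ i : WithTop Γ))
    (w : Polynomial K → WithTop Γ)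
    (hw : ∀ f : Polynomial K, ∃ i₀ : I, ∀ i : I, i₀ ≤ i → v (f.eval (a i)) = w f)
    {Λ : Type*} [AddCommGroup Λ] [LinearOrder Λ] [IsOrderedAddMonoid Λ] (e : Γ →+ Λ) (he : StrictMono e)
    (μ : Polynomial K → WithTop Λ)
    (hμmul : ∀ f g : Polynomial K, μ (f * g) = μ f + μ g)
    (hμadd : ∀ f g : Polynomial K, min (μ f) (μ g) ≤ μ (f + g))
    (hμone : μ 1 = 0) (hμzero : μ 0 = ⊤)
    (hμext : ∀ c : K, μ (Polynomial.C c) = WithTop.map (⇑e) (v c))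
    (hμup : ∀ (i : I) (f : Polynomial K), WithTop.map (⇑e) (mval v (a i) (γ i) f) ≤ μ f) :
    -- (1) `w` is a valuation on `K[x]` extending `v`
    ((∀ f g : Polynomial K, w (f * g) = w f + w g) ∧
      (∀ f g : Polynomial K, min (w f) (w g) ≤ w (f + g)) ∧
      w 1 = 0 ∧ w 0 = ⊤ ∧ (∀ c : K, w (Polynomial.C c) = v c)) ∧
    -- (2) `w` dominates every `ν_i`
    (∀ (i : I) (f : Polynomial K), mval v (a i) (γ i) f ≤ w f) ∧
    -- (3) `w` is the least valuation dominating the family `{ν_i}`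
    (∀ f : Polynomial K, WithTop.map (⇑e) (w f) ≤ μ f) := by
  classical
  obtain ⟨V, hV⟩ := aux_exists_addValuation v hv
  obtain rfl : v = fun x => V x := funext fun x => (hV x).symm
  simp only at *
  haveI : NoMaxOrder I := ⟨hnomax⟩
  have hw' : ∀ f : Polynomial K, ∀ᶠ i in Filter.atTop, V (f.eval (a i)) = w f := by
    intro f
    obtain ⟨i₀, h⟩ := hw f
    exact Filter.eventually_atTop.2 ⟨i₀, h⟩
  have hmono : StrictMono γ := by
    intro i j hij
    obtain ⟨k, hk⟩ := hnomax j
    have h := hpc i j k hij hk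
    rw [V.map_sub_swap, hγ i j hij, V.map_sub_swap, hγ j k hk] at h
    exact_mod_cast h
  have hval : ∀ i j : I, i < j → ∀ (c : K) (k : ℕ),
      V (c * (a j - a i) ^ k) = V c + ((k • γ i : Γ) : WithTop Γ) := by
    intro i j hij c k
    rw [V.map_mul, V.map_pow, hγ i j hij, WithTop.coe_nsmul]
  have heval : ∀ (i j : I) (f : Polynomial K), f.eval (a j) =
      ∑ k ∈ Finset.range (f.natDegree + 1), (taylor (a i) f).coeff k * (a j - a i) ^ k := by
    intro i j f
    have h : (taylor (a i) f).eval (a j - a i) = f.eval (a j) := by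
      rw [taylor_eval, sub_add_cancel]
    rw [← h, eval_eq_sum_range, natDegree_taylor]
  refine ⟨⟨?_, ?_, ?_, ?_, ?_⟩, ?_, ?_⟩
  · intro f g
    obtain ⟨i, h1, h2, h3⟩ := ((hw' f).and ((hw' g).and (hw' (f * g)))).exists
    rw [← h1, ← h2, ← h3, eval_mul, V.map_mul]
  · intro f g
    obtain ⟨i, h1, h2, h3⟩ := ((hw' f).and ((hw' g).and (hw' (f + g)))).exists
    rw [← h1, ← h2, ← h3, eval_add]
    exact V.map_add _ _
  · obtain ⟨i, h⟩ := (hw' 1).exists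
    rw [← h, eval_one, V.map_one]
  · obtain ⟨i, h⟩ := (hw' 0).exists
    rw [← h, eval_zero, V.map_zero]
  · intro c
    obtain ⟨i, h⟩ := (hw' (C c)).exists
    rw [← h, eval_C]
  · intro i f
    obtain ⟨j, h, hij⟩ := ((hw' f).and (Filter.eventually_gt_atTop i)).exists
    rw [← h, heval i j f]
    refine V.map_le_sum fun k hk => ?_
    rw [hval i j hij]
    exact Finset.inf_le hk
  · intro f
    have hpair : ∀ k l : ℕ, k < l → ∀ᶠ i in Filter.atTop,
        V ((taylor (a i) f).coeff k) + ((k • γ i : Γ) : WithTop Γ) =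
          V ((taylor (a i) f).coeff l) + ((l • γ i : Γ) : WithTop Γ) →
        V ((taylor (a i) f).coeff k) + ((k • γ i : Γ) : WithTop Γ) = ⊤ := by
      intro k l hkl
      simp only [taylor_coeff]
      have h1 := hw' (hasseDeriv k f)
      have h2 := hw' (hasseDeriv l f)
      generalize w (hasseDeriv k f) = b at h1
      generalize w (hasseDeriv l f) = c at h2
      induction b with
      | top =>
        filter_upwards [h1] with i hi _
        rw [hi, top_add]
      | coe b =>
        induction c with
        | top =>
          filter_upwards [h2] with i hi he
          rw [he, hi, top_add]
        | coe c =>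
          by_cases hex : ∃ i, b + k • γ i = c + l • γ i
          · obtain ⟨i₀, hi₀⟩ := hex
            filter_upwards [h1, h2, Filter.eventually_gt_atTop i₀] with i e1 e2 hi he
            rw [e1, e2] at he
            exact absurd (by exact_mod_cast he) (aux_lines b c _ _ k l hkl (hmono hi) hi₀)
          · filter_upwards [h1, h2] with i e1 e2 he
            rw [e1, e2] at he
            exact absurd ⟨i, by exact_mod_cast he⟩ hex
    have hall : ∀ᶠ i in Filter.atTop, ∀ k ∈ Finset.range (f.natDegree + 1),
        ∀ l ∈ Finset.range (f.natDegree + 1), k < l →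
        V ((taylor (a i) f).coeff k) + ((k • γ i : Γ) : WithTop Γ) =
          V ((taylor (a i) f).coeff l) + ((l • γ i : Γ) : WithTop Γ) →
        V ((taylor (a i) f).coeff k) + ((k • γ i : Γ) : WithTop Γ) = ⊤ := by
      rw [Filter.eventually_all_finset]
      intro k _
      rw [Filter.eventually_all_finset]
      intro l _
      by_cases hkl : k < l
      · filter_upwards [hpair k l hkl] with i hi _ using hi
      · exact Filter.Eventually.of_forall fun i h => absurd h hkl
    obtain ⟨i, hi⟩ := hall.exists
    obtain ⟨j, hj, hij⟩ := ((hw' f).and (Filter.eventually_gt_atTop i)).exists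
    have key : w f = mval (fun x => V x) (a i) (γ i) f := by
      rw [← hj, heval i j f, aux_sum_distinct V]
      · unfold mval
        simp only [hval i j hij]
      · intro k hk l hl hkl he
        rw [hval i j hij, hval i j hij] at he
        rw [hval i j hij]
        rcases lt_or_gt_of_ne hkl with h | h
        · exact hi k hk l hl h he
        · rw [he]
          exact hi l hl k hk h he.symm
    rw [key]
    exact hμup i f
end

section
/- Let (K, v) be a valued field with K algebraically closed, let Λ be a linearly ordered abelian group containing the value group of v as an ordered subgroup, and let ν be a valuation on K[x] with values in Λ ∪ {∞} extending v. Suppose there exists c ∈ K such that ν(x − b) ≤ ν(x − c) for every b ∈ K, and set γ := ν(x − c). Then ν = v_{c,γ}, i.e., for every f ∈ K[x], ν(f) = min_{0 ≤ i ≤ r} (v(c_i) + i·γ), where f = c_0 + c_1(x−c) + … + c_r(x−c)^r is the Taylor expansion of f at c. -/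
open Polynomial

theorem stmt18_aux {K Λ : Type*} [Field K] [IsAlgClosed K]
    [AddCommGroup Λ] [LinearOrder Λ] [IsOrderedAddMonoid Λ]
    (ν : Polynomial K → WithTop Λ)
    (hνmul : ∀ f g : Polynomial K, ν (f * g) = ν f + ν g)
    (hνadd : ∀ f g : Polynomial K, min (ν f) (ν g) ≤ ν (f + g))
    (hνone : ν 1 = 0) (hνzero : ν 0 = ⊤)
    (c : K) (hc : ∀ b : K, ν (X - C b) ≤ ν (X - C c)) (n : ℕ) :
    ∀ f : Polynomial K, f.natDegree = n → ∀ i : ℕ,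
      ν f ≤ ν (C ((Polynomial.taylor c f).coeff i)) + i • ν (X - C c) := by
  have hneg : 0 ≤ ν (-1) := by
    by_contra h
    rw [not_le] at h
    have h1 : ν (-1) + ν (-1) = 0 := by rw [← hνmul]; simpa using hνone
    have h2 : ν (-1) + ν (-1) ≤ ν (-1) + 0 := by gcongr
    rw [h1, add_zero] at h2
    exact absurd h (not_lt.mpr h2)
  have hsub : ∀ b : K, ν (X - C b) ≤ ν (C (c - b)) := by
    intro b
    have h1 : (C (c - b) : K[X]) = (X - C b) + (-1) * (X - C c) := by
      rw [C_sub]; ring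
    rw [h1]
    refine le_trans (le_min le_rfl ?_) (hνadd _ _)
    rw [hνmul]
    calc ν (X - C b) ≤ 0 + ν (X - C c) := by rw [zero_add]; exact hc b
      _ ≤ _ := by gcongr
  induction n with
  | zero =>
    intro f hf i
    obtain ⟨a, rfl⟩ := natDegree_eq_zero.mp hf
    rw [taylor_C]
    rcases i with _ | i
    · simp
    · rw [coeff_C_succ, C_0, hνzero]; simp
  | succ n ih =>
    intro f hf i
    have hd : f.degree ≠ 0 := by
      intro h
      rw [natDegree_eq_of_degree_eq_some (n := 0) (by simpa using h)] at hf
      omega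
    obtain ⟨b, hb⟩ := IsAlgClosed.exists_root f hd
    obtain ⟨h, rfl⟩ := dvd_iff_isRoot.mpr hb
    have hh : h ≠ 0 := by rintro rfl; simp at hf
    have hdeg : h.natDegree = n := by
      rw [natDegree_mul (X_sub_C_ne_zero b) hh, natDegree_X_sub_C] at hf
      omega
    have key := ih h hdeg
    have ht : taylor c ((X - C b) * h) = X * taylor c h + C (c - b) * taylor c h := by
      rw [taylor_mul, map_sub, taylor_X, taylor_C, C_sub]; ring
    rw [hνmul, ht, coeff_add, coeff_C_mul]
    have h2 : ν (X - C b) + ν h ≤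
        ν (C ((c - b) * (taylor c h).coeff i)) + i • ν (X - C c) := by
      rw [C_mul, hνmul, add_assoc]
      exact add_le_add (hsub b) (key i)
    rcases i with _ | i
    · rw [coeff_X_mul_zero, zero_add]; exact h2
    · rw [coeff_X_mul, C_add]
      have h1 : ν (X - C b) + ν h ≤
          ν (C ((taylor c h).coeff i)) + (i + 1) • ν (X - C c) := by
        rw [succ_nsmul, ← add_assoc, add_comm (ν (X - C b))]
        exact add_le_add (key i) (hc b)
      refine le_trans ?_ (add_le_add_left (hνadd _ _) _)
      rcases min_choice (ν (C ((taylor c h).coeff i)))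
        (ν (C ((c - b) * (taylor c h).coeff (i + 1)))) with h3 | h3 <;> rw [h3]
      · exact h1
      · exact h2

/-- over an algebraically closed valued field, a valuation `ν` on `K[x]`
extending `v` (via a strictly monotone embedding `e : Γ → Λ` of the value group) for
which `ν(x − c)` is maximal among all `ν(x − b)` equals the monomial valuation `v_{c,γ}`
with `γ = ν(x − c)`:
`ν(f) = min_i (v(c_i) + i·γ)` where `f = Σ c_i (x − c)^i` is the Taylor expansion at `c`. -/
theorem stmt18 {K Γ Λ : Type*} [Field K] [IsAlgClosed K]
    [AddCommGroup Γ] [LinearOrder Γ] [IsOrderedAddMonoid Γ] [AddCommGroup Λ] [LinearOrder Λ] [IsOrderedAddMonoid Λ]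
    (v : K → WithTop Γ) (hv : IsValdF v)
    (e : Γ →+ Λ) (he : StrictMono e)
    (ν : Polynomial K → WithTop Λ)
    (hνmul : ∀ f g : Polynomial K, ν (f * g) = ν f + ν g)
    (hνadd : ∀ f g : Polynomial K, min (ν f) (ν g) ≤ ν (f + g))
    (hνone : ν 1 = 0) (hνzero : ν 0 = ⊤)
    (hνext : ∀ b : K, ν (Polynomial.C b) = WithTop.map (⇑e) (v b))
    (c : K) (hc : ∀ b : K, ν (X - C b) ≤ ν (X - C c)) :
    ∀ f : Polynomial K,
      ν f = (Finset.range (f.natDegree + 1)).inf fun i =>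
        WithTop.map (⇑e) (v ((Polynomial.taylor c f).coeff i)) + i • ν (X - C c) := by
  intro f
  have hpow : ∀ i : ℕ, ν ((X - C c) ^ i) = i • ν (X - C c) := by
    intro i
    induction i with
    | zero => simpa using hνone
    | succ i ih => rw [pow_succ, hνmul, ih, succ_nsmul]
  have hsum : ∀ (s : Finset ℕ) (g : ℕ → K[X]), (s.inf fun i => ν (g i)) ≤ ν (∑ i ∈ s, g i) := by
    intro s g
    induction s using Finset.induction_on with
    | empty => simp [hνzero]
    | insert a s ha ih =>
      rw [Finset.inf_insert, Finset.sum_insert ha]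
      exact le_trans (inf_le_inf_left _ ih) (hνadd _ _)
  simp only [← hνext]
  apply le_antisymm
  · exact Finset.le_inf fun i _ =>
      stmt18_aux ν hνmul hνadd hνone hνzero c hc f.natDegree f rfl i
  · have hf : f = ∑ i ∈ Finset.range (f.natDegree + 1),
        C ((taylor c f).coeff i) * (X - C c) ^ i := by
      conv_lhs => rw [← sum_taylor_eq f c]
      rw [sum_over_range' _ (by simp) (f.natDegree + 1) (by rw [natDegree_taylor]; omega)]
    conv_rhs => rw [hf]
    refine le_trans (le_of_eq ?_) (hsum _ _)
    simp only [hνmul, hpow]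
end

section
/- Let (K, v) be a valued field. For every approximation type A over (K, v), there exists a pseudo-Cauchy sequence {a_i}_{i∈I} in K such that A = {B : B is a closed ball and B(a_i, γ_i) ⊆ B for some i ∈ I*}, where γ_i denotes the common value v(a_j − a_i) for j > i, and I* equals I with its greatest element removed if I has a greatest element, and I* = I otherwise. In other words, the map ι from pseudo-Cauchy sequences to approximation types, sending {a_i}_{i∈I} to the set of closed balls containing some B(a_i, γ_i) with i ∈ I*, is surjective. -/
/-- `B` is a closed ball in `K` with radius in the value group of `v`. -/
def IsClosedBall {K Γ : Type*} [Field K] [AddCommGroup Γ] [LinearOrder Γ] [IsOrderedAddMonoid Γ]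
    (v : K → WithTop Γ) (B : Set K) : Prop :=
  ∃ (a : K) (γ : Γ), (∃ c : K, v c = (γ : WithTop Γ)) ∧
    B = {b : K | (γ : WithTop Γ) ≤ v (b - a)}

/-- A nest of balls: a nonempty collection of closed balls totally ordered by inclusion. -/
def IsNest {K Γ : Type*} [Field K] [AddCommGroup Γ] [LinearOrder Γ] [IsOrderedAddMonoid Γ]
    (v : K → WithTop Γ) (𝒞 : Set (Set K)) : Prop :=
  𝒞.Nonempty ∧ (∀ B ∈ 𝒞, IsClosedBall v B) ∧
    ∀ B₁ ∈ 𝒞, ∀ B₂ ∈ 𝒞, B₁ ⊆ B₂ ∨ B₂ ⊆ B₁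

/-- An approximation type: a nest of balls containing every closed ball that contains one
of its members. -/
def IsApproxType {K Γ : Type*} [Field K] [AddCommGroup Γ] [LinearOrder Γ] [IsOrderedAddMonoid Γ]
    (v : K → WithTop Γ) (A : Set (Set K)) : Prop :=
  IsNest v A ∧ ∀ B : Set K, IsClosedBall v B → (∃ B' ∈ A, B' ⊆ B) → B ∈ A

universe u₁ u₂

namespace Stmt19Aux

section
variable {K Γ : Type*} [Field K] [AddCommGroup Γ] [LinearOrder Γ] [IsOrderedAddMonoid Γ]
  {v : K → WithTop Γ}

theorem v_one (hv : IsValdF v) : v 1 = 0 := by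
  have h := hv.1 1 1
  have h1 : v 1 ≠ ⊤ := fun h => one_ne_zero ((hv.2.2 1).1 h)
  lift v 1 to Γ using h1 with g hg
  rw [mul_one, ← hg] at h
  norm_cast at h ⊢
  simpa using h

theorem exists_addVal (hv : IsValdF v) : ∃ w : AddValuation K (WithTop Γ), ∀ x, w x = v x :=
  ⟨AddValuation.of v ((hv.2.2 0).2 rfl) (v_one hv) hv.2.1 hv.1, fun _ => rfl⟩

theorem v_neg (hv : IsValdF v) (x : K) : v (-x) = v x := by
  obtain ⟨w, hw⟩ := exists_addVal hv
  rw [← hw, ← hw]; exact w.map_neg x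

theorem v_swap (hv : IsValdF v) (x y : K) : v (x - y) = v (y - x) := by
  rw [← v_neg hv, neg_sub]

theorem v_add_lt (hv : IsValdF v) {x y : K} (h : v x < v y) : v (x + y) = v x := by
  obtain ⟨w, hw⟩ := exists_addVal hv
  rw [← hw, ← hw] at *
  exact w.map_add_eq_of_lt_left h

theorem ball_spec (hv : IsValdF v) {B : Set K} (hB : IsClosedBall v B) :
    ∃ δ : WithTop Γ, ∀ x ∈ B, ∀ y, y ∈ B ↔ δ ≤ v (y - x) := by
  obtain ⟨a, g, -, rfl⟩ := hB
  refine ⟨g, fun x hx y => ?_⟩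
  simp only [Set.mem_ofPred_eq] at hx ⊢
  constructor
  · intro hy
    have := hv.2.1 (y - a) (a - x)
    rw [sub_add_sub_cancel, v_swap hv a x] at this
    exact (le_min hy hx).trans this
  · intro hy
    have := hv.2.1 (y - x) (x - a)
    rw [sub_add_sub_cancel] at this
    exact (le_min hy hx).trans this

end

end Stmt19Aux

open Stmt19Aux in
/-- the map `ι` from pseudo-Cauchy sequences to approximation types is
surjective: every approximation type `A` over `(K, v)` arises as the set of closed balls
containing some ball `B(a_i, γ_i)`, `i ∈ I*`, for a pseudo-Cauchy sequence `{a_i}_{i∈I}`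
in `K` indexed by a well-ordered set `I` with at least two elements (here `i ∈ I*` means
`i` is not the greatest element of `I`, and `γ_i` is the common value `v(a_j − a_i)` for
`j > i`). -/
theorem stmt19 {K : Type u₁} {Γ : Type u₂} [Field K] [AddCommGroup Γ] [LinearOrder Γ] [IsOrderedAddMonoid Γ]
    (v : K → WithTop Γ) (hv : IsValdF v)
    (A : Set (Set K)) (hA : IsApproxType v A) :
    ∃ (I : Type (max u₁ u₂)) (linI : LinearOrder I), WellFounded linI.lt ∧
      ∃ (a : I → K) (γ : I → Γ),
        (∃ i j : I, linI.lt i j) ∧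
        (∀ i j k : I, linI.lt i j → linI.lt j k → v (a i - a j) < v (a j - a k)) ∧
        (∀ i j : I, linI.lt i j → v (a j - a i) = (γ i : WithTop Γ)) ∧
        A = {B : Set K | IsClosedBall v B ∧
          ∃ i : I, (∃ j : I, linI.lt i j) ∧
            {b : K | (γ i : WithTop Γ) ≤ v (b - a i)} ⊆ B} := by
  obtain ⟨⟨hne, hball, htot⟩, hup⟩ := hA
  by_cases hmin : ∃ B ∈ A, ∀ C ∈ A, B ⊆ C
  · obtain ⟨B, hBA, hBmin⟩ := hmin
    obtain ⟨a, g, ⟨c, hc⟩, hB⟩ := hball B hBA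
    have key : {b : K | (g : WithTop Γ) ≤ v (b - (a + c))} = B := by
      have haB : a + c ∈ B := by rw [hB]; simp [hc]
      obtain ⟨δ, hδ⟩ := ball_spec hv (hball B hBA)
      rw [hB]
      ext b
      simp only [Set.mem_ofPred_eq]
      constructor
      · intro h
        have := hv.2.1 (b - (a + c)) c
        rw [hc, show b - (a + c) + c = b - a by ring] at this
        exact (le_min h le_rfl).trans this
      · intro h
        have := hv.2.1 (b - a) (-c)
        rw [v_neg hv, hc, show b - a + -c = b - (a + c) by ring] at this
        exact (le_min h le_rfl).trans this
    have lt2 : ∀ i j : ULift.{max u₁ u₂} Bool, i < j → i = ⟨false⟩ ∧ j = ⟨true⟩ := by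
      rintro ⟨i⟩ ⟨j⟩ h
      have h' : i < j := h
      revert h'
      clear h
      cases i <;> cases j <;> simp <;> decide
    have lt01 : (⟨false⟩ : ULift.{max u₁ u₂} Bool) < ⟨true⟩ := by
      change false < true
      simp
    refine ⟨ULift.{max u₁ u₂} Bool, inferInstance, wellFounded_lt,
      fun i => if i.down then a else a + c, fun _ => g, ⟨⟨false⟩, ⟨true⟩, lt01⟩, ?_, ?_, ?_⟩
    · intro i j k hij hjk
      have h1 := (lt2 i j hij).2
      have h2 := (lt2 j k hjk).1
      simp [h1] at h2
    · intro i j hij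
      obtain ⟨rfl, rfl⟩ := lt2 i j hij
      simp [v_neg hv, hc]
    · ext C
      constructor
      · intro hC
        refine ⟨hball C hC, ⟨false⟩, ⟨⟨true⟩, lt01⟩, ?_⟩
        simp only [Bool.false_eq_true, if_false]
        rw [key]
        exact hBmin C hC
      · rintro ⟨hC, i, ⟨j, hij⟩, hs⟩
        obtain ⟨rfl, rfl⟩ := lt2 i j hij
        simp only [Bool.false_eq_true, if_false] at hs
        rw [key] at hs
        exact hup C hC ⟨B, hBA, hs⟩
  · push Not at hmin
    classical
    let r : Set K → Set K → Prop := WellOrderingRel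
    have rwf : WellFounded r := IsWellFounded.wf
    let S : Set (Set K) := {B | B ∈ A ∧ ∀ B' ∈ A, r B' B → B ⊂ B'}
    have hcof : ∀ C ∈ A, ∃ B ∈ S, B ⊆ C := by
      intro C hC
      obtain ⟨B, ⟨hBA, hBC⟩, hB⟩ := rwf.has_min {B | B ∈ A ∧ B ⊆ C} ⟨C, hC, subset_rfl⟩
      refine ⟨B, ⟨hBA, fun B' hB' hr => ?_⟩, hBC⟩
      have h1 : ¬ B' ⊆ C := fun h => hB B' ⟨hB', h⟩ hr
      have h2 := (htot B' hB' C hC).resolve_left h1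
      exact ⟨hBC.trans h2, fun h => h1 (h.trans hBC)⟩
    let f : ULift.{u₂} S → Set K := fun i => i.down.1
    have finj : Function.Injective f := fun i j h => ULift.ext _ _ (Subtype.ext h)
    let linK : LinearOrder (Set K) := linearOrderOfSTO r
    let linI : LinearOrder (ULift.{u₂} S) := @LinearOrder.lift' _ _ linK f finj
    have lt_def : ∀ i j : ULift.{u₂} S, linI.lt i j ↔ r (f i) (f j) := fun i j => Iff.rfl
    have hwf : WellFounded linI.lt := InvImage.wf f rwf
    have fA : ∀ i, f i ∈ A := fun i => i.down.2.1
    have hlt : ∀ i j, linI.lt i j → f j ⊂ f i := fun i j h => j.down.2.2 _ (fA i) h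
    have hnomax : ∀ i, ∃ j, linI.lt i j := by
      intro i
      obtain ⟨C, hC, hiC⟩ := hmin (f i) (fA i)
      obtain ⟨B, hB, hBC⟩ := hcof C hC
      refine ⟨⟨⟨B, hB⟩⟩, ?_⟩
      rcases @lt_trichotomy _ linI i ⟨⟨B, hB⟩⟩ with h | h | h
      · exact h
      · exact absurd (by rw [h]; exact hBC) hiC
      · exact absurd ((hlt _ _ h).1.trans hBC) hiC
    have hsucc : ∀ i, ∃ j, linI.lt i j ∧ ∀ k, linI.lt i k → f k ⊆ f j := by
      intro i
      obtain ⟨j, hj, hjm⟩ := hwf.has_min {j | linI.lt i j} (hnomax i)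
      refine ⟨j, hj, fun k hk => ?_⟩
      rcases @lt_trichotomy _ linI j k with h | h | h
      · exact (hlt _ _ h).1
      · rw [h]
      · exact absurd h (hjm k hk)
    choose s hs hsub using hsucc
    have hpt : ∀ i, ∃ x, x ∈ f i ∧ x ∉ f (s i) := fun i =>
      Set.exists_of_ssubset (hlt _ _ (hs i))
    choose a ha ha' using hpt
    have hmem : ∀ i j, linI.lt i j → a j ∈ f (s i) := fun i j h => hsub i j h (ha j)
    have hγ : ∀ i, ∃ g : Γ, v (a (s i) - a i) = (g : WithTop Γ) := by
      intro i
      have : v (a (s i) - a i) ≠ ⊤ := by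
        intro h
        have h := sub_eq_zero.1 ((hv.2.2 _).1 h)
        apply ha' i
        rw [← h]
        exact ha _
      exact ⟨_, (WithTop.coe_untop _ this).symm⟩
    choose γ hγ using hγ
    have hclose : ∀ i, ∀ x ∈ f (s i), ∀ y ∈ f (s i), v (x - a i) < v (y - x) := by
      intro i x hx y hy
      obtain ⟨δ, hδ⟩ := ball_spec hv (hball _ (fA (s i)))
      have h1 := (hδ x hx y).1 hy
      have h2 := mt (hδ x hx (a i)).2 (ha' i)
      rw [v_swap hv]
      exact (not_le.1 h2).trans_le h1
    have hval : ∀ i, ∀ x ∈ f (s i), v (x - a i) = (γ i : WithTop Γ) := by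
      intro i x hx
      have h := v_add_lt hv (hclose i _ (ha (s i)) x hx)
      rw [← hγ, ← h]
      congr 1
      ring
    refine ⟨ULift.{u₂} S, linI, hwf, a, γ, ?_, ?_, ?_, ?_⟩
    · obtain ⟨C, hC⟩ := hne
      obtain ⟨B, hB, -⟩ := hcof C hC
      exact ⟨⟨⟨B, hB⟩⟩, hnomax _⟩
    · intro i j k hij hjk
      have := hclose i (a j) (hmem i j hij) (a k) (hmem i k (@lt_trans _ linI.toPreorder _ _ _ hij hjk))
      rwa [v_swap hv (a i), v_swap hv (a j) (a k)]
    · intro i j hij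
      exact hval i _ (hmem i j hij)
    · ext B
      constructor
      · intro hB
        obtain ⟨C, hC, hCB⟩ := hcof B hB
        let i : ULift.{u₂} S := ⟨⟨C, hC⟩⟩
        refine ⟨hball B hB, i, hnomax i, fun b hb => hCB ?_⟩
        obtain ⟨δ, hδ⟩ := ball_spec hv (hball _ (fA i))
        have h1 := (hδ _ (ha i) (a (s i))).1 ((hlt _ _ (hs i)).1 (ha (s i)))
        rw [hγ] at h1
        exact (hδ _ (ha i) b).2 (h1.trans hb)
      · rintro ⟨hB, i, -, hi⟩
        exact hup B hB ⟨f (s i), fA _, fun b hb => hi (hval i b hb).ge⟩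
end
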